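/- arXiv:1306.0136 — 2 statements merged into one kernel-verified Lean document; each statement's English description precedes it below -/
import Mathlib

section
/- For every nonnegative integer k that is not divisible by 7, the number of 3-regular partitions of 7k+4 is divisible by 9, i.e., b_3(7k+4) ≡ 0 (mod 9) whenever 7 ∤ k. -/
/-- `numRegular ℓ n` is the number of `ℓ`-regular partitions of `n`,
i.e. partitions of `n` none of whose parts is divisible by `ℓ`. -/
def numRegular (ℓ n : ℕ) : ℕ :=
  (Finset.univ.filter fun p : Nat.Partition n => ∀ i ∈ p.parts, ¬ ℓ ∣ i).card

open PowerSeries PowerSeries.WithPiTopology Filter Finset Topology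

/-- The expansion of `X ^ i / (1 - X ^ i)`. -/
def geomX (R : Type*) [CommRing R] (i : ℕ) : R⟦X⟧ :=
  .mk fun n ↦ if i ∣ n ∧ n ≠ 0 then 1 else 0

/-- The expansion of `X ^ i / (1 - X ^ i) ^ 2`. -/
def geomSqX (R : Type*) [CommRing R] (i : ℕ) : R⟦X⟧ :=
  .mk fun n ↦ if i ∣ n then ((n / i : ℕ) : R) else 0

/-- The generating function of the sum of divisors. -/
def sigmaSeries (R : Type*) [CommRing R] : R⟦X⟧ :=
  .mk fun n ↦ ((∑ d ∈ n.divisors, d : ℕ) : R)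

section

variable {R : Type*} [CommRing R]

theorem geomX_mul_one_sub {i : ℕ} (hi : 0 < i) : geomX R i * (1 - X ^ i) = X ^ i := by
  ext n
  rw [mul_sub, mul_one, map_sub, coeff_mul_X_pow', coeff_X_pow, geomX, coeff_mk]
  by_cases h : i ≤ n
  · obtain ⟨m, rfl⟩ := Nat.exists_eq_add_of_le h
    rcases Nat.eq_zero_or_pos m with rfl | hm
    · simp [hi.ne']
    · simp [hm.ne']
  · have h1 : ¬ (i ∣ n ∧ n ≠ 0) := fun ⟨h1, h2⟩ ↦ h (Nat.le_of_dvd (Nat.pos_of_ne_zero h2) h1)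
    have h2 : n ≠ i := by omega
    simp [h, h1, h2]

theorem geomSqX_mul_one_sub {i : ℕ} (hi : 0 < i) :
    geomSqX R i * (1 - X ^ i) = geomX R i := by
  ext n
  rw [mul_sub, mul_one, map_sub, coeff_mul_X_pow', geomSqX, geomX, coeff_mk, coeff_mk]
  by_cases h : i ≤ n
  · obtain ⟨m, rfl⟩ := Nat.exists_eq_add_of_le h
    by_cases hm : i ∣ m
    · simp [hm, hi.ne', Nat.add_div_left m hi]
    · simp [hm]
  · have h1 : ¬ (i ∣ n ∧ n ≠ 0) := fun ⟨h1, h2⟩ ↦ h (Nat.le_of_dvd (Nat.pos_of_ne_zero h2) h1)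
    have h2 : n / i = 0 := Nat.div_eq_of_lt (by omega)
    simp [h, h1, h2]

theorem prod_sum_range_three_X_pow (h9 : (9 : R⟦X⟧) = 0) (s : Finset ℕ) :
    ∏ i ∈ s, ∑ j ∈ range 3, (X : R⟦X⟧) ^ ((i + 1) * j) =
      (∏ i ∈ s, (1 - X ^ (i + 1))) ^ 2 * (1 + 3 * ∑ i ∈ s, geomSqX R (i + 1)) := by
  classical
  induction s using Finset.induction_on with
  | empty => simp
  | insert a s ha ih =>
    rw [prod_insert ha, prod_insert ha, sum_insert ha, ih]
    have h := geomX_mul_one_sub (R := R) a.succ_pos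
    rw [← geomSqX_mul_one_sub a.succ_pos] at h
    simp only [sum_range_succ, range_zero, sum_empty, pow_mul]
    simp only [Nat.succ_eq_add_one] at h
    set x : R⟦X⟧ := X ^ (a + 1)
    set P := ∏ i ∈ s, (1 - (X : R⟦X⟧) ^ (i + 1))
    set A := geomSqX R (a + 1)
    set S := ∑ i ∈ s, geomSqX R (i + 1)
    linear_combination (-3 * P ^ 2 * (1 + 3 * S)) * h + P ^ 2 * (1 - x) ^ 2 * A * S * h9

theorem X_mul_derivative_prod_one_sub_X_pow (s : Finset ℕ) :
    X * d⁄dX R (∏ i ∈ s, (1 - (X : R⟦X⟧) ^ (i + 1))) =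
      -((∏ i ∈ s, (1 - X ^ (i + 1))) * ∑ i ∈ s, ((i + 1 : ℕ) : R⟦X⟧) * geomX R (i + 1)) := by
  classical
  induction s using Finset.induction_on with
  | empty => simp
  | insert a s ha ih =>
    rw [prod_insert ha, sum_insert ha, Derivation.leibniz]
    have h := geomX_mul_one_sub (R := R) a.succ_pos
    have hd : X * d⁄dX R (1 - (X : R⟦X⟧) ^ (a + 1)) = -(((a + 1 : ℕ) : R⟦X⟧) * X ^ (a + 1)) := by
      rw [map_sub, Derivation.leibniz_pow]
      simp [pow_succ]
      ring
    simp only [smul_eq_mul, Nat.succ_eq_add_one] at h ⊢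
    linear_combination (1 - X ^ (a + 1)) * ih + (∏ i ∈ s, (1 - (X : R⟦X⟧) ^ (i + 1))) * hd +
      (∏ i ∈ s, (1 - (X : R⟦X⟧) ^ (i + 1))) * ((a + 1 : ℕ) : R⟦X⟧) * h

theorem sum_ite_succ_dvd {n : ℕ} (hn : n ≠ 0) {s : Finset ℕ} (hs : range n ⊆ s) (f : ℕ → R) :
    ∑ i ∈ s, (if i + 1 ∣ n then f (i + 1) else 0) = ∑ d ∈ n.divisors, f d := by
  rw [← sum_filter]
  refine sum_bij (fun i _ ↦ i + 1) ?_ ?_ ?_ ?_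
  · intro i hi
    simpa [hn] using (mem_filter.mp hi).2
  · intro a _ b _ h
    simpa using h
  · intro d hd
    have hd0 := Nat.pos_of_mem_divisors hd
    have hdn := Nat.divisor_le hd
    refine ⟨d - 1, mem_filter.mpr ⟨hs (mem_range.mpr (by omega)), ?_⟩, by omega⟩
    rw [Nat.sub_add_cancel hd0]
    exact Nat.dvd_of_mem_divisors hd
  · intro i _
    rfl

variable [TopologicalSpace R]

theorem hasSum_geomSqX : HasSum (fun i ↦ geomSqX R (i + 1)) (sigmaSeries R) := by
  rw [HasSum, tendsto_iff_coeff_tendsto]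
  refine fun n ↦ tendsto_atTop_of_eventually_const (i₀ := range n) fun s hs ↦ ?_
  rw [map_sum, sigmaSeries, coeff_mk]
  simp only [geomSqX, coeff_mk]
  rcases eq_or_ne n 0 with rfl | hn
  · simp
  · rw [sum_ite_succ_dvd hn hs fun d ↦ ((n / d : ℕ) : R), ← Nat.cast_sum]
    congr 1
    exact Nat.sum_div_divisors n fun d ↦ d

theorem hasSum_natCast_mul_geomX :
    HasSum (fun i ↦ ((i + 1 : ℕ) : R⟦X⟧) * geomX R (i + 1)) (sigmaSeries R) := by
  rw [HasSum, tendsto_iff_coeff_tendsto]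
  refine fun n ↦ tendsto_atTop_of_eventually_const (i₀ := range n) fun s hs ↦ ?_
  rw [map_sum, sigmaSeries, coeff_mk]
  have h (i : ℕ) : coeff n (((i + 1 : ℕ) : R⟦X⟧) * geomX R (i + 1)) =
      if i + 1 ∣ n ∧ n ≠ 0 then ((i + 1 : ℕ) : R) else 0 := by
    rw [← map_natCast (C (R := R)), coeff_C_mul, geomX, coeff_mk, mul_ite, mul_one, mul_zero]
  simp only [h]
  rcases eq_or_ne n 0 with rfl | hn
  · simp
  · simp only [ne_eq, hn, not_false_eq_true, and_true]
    rw [sum_ite_succ_dvd hn hs fun d ↦ (d : R), Nat.cast_sum]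

variable [IsTopologicalRing R] [T2Space R]

theorem powerSeriesMk_card_countRestricted_three (h9 : (9 : R⟦X⟧) = 0) :
    (.mk fun n ↦ (#(Nat.Partition.countRestricted n 3) : R)) =
      pentagonalSeries R ^ 2 * (1 + 3 * sigmaSeries R) := by
  have h := Nat.Partition.hasProd_powerSeriesMk_card_countRestricted R (m := 3) (by norm_num)
  simp only [HasProd, SummationFilter.unconditional_filter, prod_sum_range_three_X_pow h9] at h
  refine tendsto_nhds_unique h ?_
  exact (Tendsto.pow (hasProd_one_sub_X_pow R) 2).mul
    ((Tendsto.const_mul 3 hasSum_geomSqX).const_add 1)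

theorem X_mul_derivative_pentagonalSeries :
    X * d⁄dX R (pentagonalSeries R) = -(pentagonalSeries R * sigmaSeries R) := by
  have h1 : Tendsto (fun s : Finset ℕ ↦ X * d⁄dX R (∏ i ∈ s, (1 - (X : R⟦X⟧) ^ (i + 1)))) atTop
      (𝓝 (X * d⁄dX R (pentagonalSeries R))) := by
    refine Tendsto.const_mul X ?_
    rw [tendsto_iff_coeff_tendsto]
    intro n
    simp only [coeff_derivative]
    exact ((tendsto_iff_coeff_tendsto R _ _ _).mp (hasProd_one_sub_X_pow R) (n + 1)).mul_const _
  simp only [X_mul_derivative_prod_one_sub_X_pow] at h1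
  exact tendsto_nhds_unique h1
    (Tendsto.mul (hasProd_one_sub_X_pow R) hasSum_natCast_mul_geomX).neg

end

theorem card_countRestricted_three_eq {R : Type*} [CommRing R] (h9 : (9 : R) = 0) (n : ℕ) :
    (#(Nat.Partition.countRestricted n 3) : R) =
      (1 + 3 * n) * coeff n (pentagonalSeries R ^ 2) := by
  let : TopologicalSpace R := ⊥
  have : DiscreteTopology R := ⟨rfl⟩
  have h9' : (9 : R⟦X⟧) = 0 := by
    simpa only [map_ofNat, map_zero] using congrArg (C (R := R)) h9
  have hd : X * d⁄dX R (pentagonalSeries R ^ 2) =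
      -(2 * pentagonalSeries R ^ 2 * sigmaSeries R) := by
    rw [Derivation.leibniz_pow]
    simp only [Nat.add_one_sub_one, pow_one, smul_eq_mul, nsmul_eq_mul]
    linear_combination 2 * pentagonalSeries R * X_mul_derivative_pentagonalSeries (R := R)
  have hG : (.mk fun n ↦ (#(Nat.Partition.countRestricted n 3) : R)) =
      pentagonalSeries R ^ 2 + C (3 : R) * (X * d⁄dX R (pentagonalSeries R ^ 2)) := by
    rw [powerSeriesMk_card_countRestricted_three h9', hd, map_ofNat]
    linear_combination pentagonalSeries R ^ 2 * sigmaSeries R * h9'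
  have hX : coeff n (X * d⁄dX R (pentagonalSeries R ^ 2)) =
      (n : R) * coeff n (pentagonalSeries R ^ 2) := by
    cases n with
    | zero => simp
    | succ n =>
      rw [coeff_succ_X_mul, coeff_derivative]
      push_cast
      ring
  have := congrArg (coeff n) hG
  rw [coeff_mk, map_add, coeff_C_mul, hX] at this
  rw [this]
  ring

theorem seven_dvd_of_pentagonal_add_pentagonal {u v : ℤ} {k : ℕ}
    (h : pentagonal u + pentagonal v = 7 * k + 4) : 7 ∣ k := by
  have hu := two_mul_natCast_pentagonal u
  have hv := two_mul_natCast_pentagonal v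
  have hsum : (pentagonal u : ℤ) + pentagonal v = 7 * k + 4 := by exact_mod_cast h
  have key : (6 * u - 1) ^ 2 + (6 * v - 1) ^ 2 = 14 * (12 * k + 7) := by
    linear_combination (-12) * hu - 12 * hv + 24 * hsum
  have hmod : ∀ a b : ZMod 7, a ^ 2 + b ^ 2 = 0 → a = 0 ∧ b = 0 := by decide
  have hab := hmod ((6 * u - 1 : ℤ) : ZMod 7) ((6 * v - 1 : ℤ) : ZMod 7) (by
    have : (((6 * u - 1) ^ 2 + (6 * v - 1) ^ 2 : ℤ) : ZMod 7) = 0 :=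
      (ZMod.intCast_zmod_eq_zero_iff_dvd _ 7).mpr ⟨2 * (12 * k + 7), by rw [key]; push_cast; ring⟩
    exact_mod_cast this)
  obtain ⟨a, ha⟩ := (ZMod.intCast_zmod_eq_zero_iff_dvd _ 7).mp hab.1
  obtain ⟨b, hb⟩ := (ZMod.intCast_zmod_eq_zero_iff_dvd _ 7).mp hab.2
  rw [ha, hb] at key
  push_cast at key
  have : 2 * (12 * (k : ℤ) + 7) = 7 * (a ^ 2 + b ^ 2) := by linarith
  omega

theorem coeff_pentagonalSeries_sq_eq_zero (R : Type*) [CommRing R] {k : ℕ} (hk : ¬ 7 ∣ k) :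
    coeff (7 * k + 4) (pentagonalSeries R ^ 2) = 0 := by
  rw [sq, coeff_mul]
  refine sum_eq_zero fun p hp ↦ ?_
  by_cases hu : p.1 ∈ Set.range pentagonal
  · by_cases hv : p.2 ∈ Set.range pentagonal
    · obtain ⟨u, hu⟩ := hu
      obtain ⟨v, hv⟩ := hv
      refine absurd (seven_dvd_of_pentagonal_add_pentagonal (u := u) (v := v) ?_) hk
      rw [hu, hv]
      exact mem_antidiagonal.mp hp
    · rw [coeff_pentagonalSeries_eq_zero R hv, mul_zero]
  · rw [coeff_pentagonalSeries_eq_zero R hu, zero_mul]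

theorem numRegular_eq_card_countRestricted (n : ℕ) {l : ℕ} (hl : 0 < l) :
    numRegular l n = #(Nat.Partition.countRestricted n l) := by
  rw [← Nat.Partition.card_restricted_eq_card_countRestricted n hl]
  rfl

/-- If `7 ∤ k` then `b_3(7k+4) ≡ 0 (mod 9)`. -/
theorem b3_seven_k_four_mod_nine (k : ℕ) (hk : ¬ 7 ∣ k) : 9 ∣ numRegular 3 (7 * k + 4) := by
  rw [numRegular_eq_card_countRestricted _ (by norm_num), ← ZMod.natCast_eq_zero_iff,
    card_countRestricted_three_eq (by decide), coeff_pentagonalSeries_sq_eq_zero _ hk, mul_zero]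
end

section
/- For every nonnegative integer n, b_9(4n+1) ≡ b_9(n) (mod 3); that is, the 9-regular partition counting function satisfies the self-similarity ∑_{n≥0} b_9(4n+1) q^n ≡ ∑_{n≥0} b_9(n) q^n (mod 3). -/
open Finset

section GaussBinom

variable {R S : Type*} [CommRing R] [CommRing S]

/-- The Gaussian binomial coefficient at `q`. -/
def gaussBinom (q : R) : ℕ → ℕ → R
  | _, 0 => 1
  | 0, _ + 1 => 0
  | n + 1, k + 1 => gaussBinom q n k + q ^ (k + 1) * gaussBinom q n (k + 1)

/-- The finite product `(1 - q) (1 - q ^ 2) ⋯ (1 - q ^ n)`. -/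
def qPoch (q : R) (n : ℕ) : R := ∏ i ∈ range n, (1 - q ^ (i + 1))

@[simp]
lemma gaussBinom_zero_right (q : R) (n : ℕ) : gaussBinom q n 0 = 1 := by
  cases n <;> rfl

lemma gaussBinom_succ_succ (q : R) (n k : ℕ) :
    gaussBinom q (n + 1) (k + 1) = gaussBinom q n k + q ^ (k + 1) * gaussBinom q n (k + 1) :=
  rfl

lemma gaussBinom_eq_zero (q : R) : ∀ {n k : ℕ}, n < k → gaussBinom q n k = 0
  | _, 0, h => absurd h (Nat.not_lt_zero _)
  | 0, _ + 1, _ => rfl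
  | n + 1, k + 1, h => by
    rw [gaussBinom_succ_succ, gaussBinom_eq_zero q (by omega : n < k),
      gaussBinom_eq_zero q (by omega : n < k + 1)]
    simp

lemma gaussBinom_self (q : R) (n : ℕ) : gaussBinom q n n = 1 := by
  induction n with
  | zero => simp
  | succ n ih => rw [gaussBinom_succ_succ, ih, gaussBinom_eq_zero q (Nat.lt_succ_self n)]; simp

lemma map_gaussBinom (f : R →+* S) (q : R) (n k : ℕ) :
    f (gaussBinom q n k) = gaussBinom (f q) n k := by
  induction n generalizing k with
  | zero => cases k <;> simp [gaussBinom]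
  | succ n ih => cases k <;> simp [gaussBinom_succ_succ, ih]

lemma qPoch_succ (q : R) (n : ℕ) : qPoch q (n + 1) = qPoch q n * (1 - q ^ (n + 1)) :=
  prod_range_succ _ _

lemma gaussBinom_mul_qPoch_mul_qPoch (q : R) (k m : ℕ) :
    gaussBinom q (k + m) k * qPoch q k * qPoch q m = qPoch q (k + m) := by
  induction k generalizing m with
  | zero => simp [qPoch]
  | succ k ihk =>
    induction m with
    | zero => simp [gaussBinom_self, qPoch]
    | succ m ihm =>
      have h := ihk (m + 1)
      rw [show k + 1 + (m + 1) = (k + 1 + m) + 1 by omega, gaussBinom_succ_succ,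
        qPoch_succ q (k + 1 + m)]
      rw [show k + (m + 1) = k + 1 + m by omega] at h
      rw [qPoch_succ q m] at h ⊢
      rw [qPoch_succ q k] at ihm ⊢
      linear_combination (1 - q ^ (k + 1)) * h + q ^ (k + 1) * (1 - q ^ (m + 1)) * ihm

open Polynomial in
/-- Gauss's `q`-binomial theorem. -/
lemma coeff_prod_one_add_mul_X (q t : R) (N k : ℕ) :
    (∏ i ∈ range N, (1 + C (t * q ^ i) * X : R[X])).coeff k =
      q ^ k.choose 2 * t ^ k * gaussBinom q N k := by
  induction N generalizing t k with
  | zero => cases k <;> simp [gaussBinom, coeff_one]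
  | succ N ih =>
    have h : ∏ i ∈ range (N + 1), (1 + C (t * q ^ i) * X : R[X]) =
        (∏ i ∈ range N, (1 + C ((t * q) * q ^ i) * X)) +
          C t * ((∏ i ∈ range N, (1 + C ((t * q) * q ^ i) * X)) * X) := by
      rw [prod_range_succ']
      simp only [pow_succ', mul_assoc, pow_zero, mul_one]
      ring
    rw [h]
    cases k with
    | zero => rw [coeff_add, ih, coeff_C_mul, coeff_mul_X_zero]; simp
    | succ k =>
      rw [coeff_add, coeff_C_mul, coeff_mul_X, ih, ih, gaussBinom_succ_succ,
        Nat.choose_succ_succ' k 1, Nat.choose_one_right]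
      ring

open Polynomial in
lemma gaussBinom_three_mul (q : R) (L k : ℕ) :
    q ^ k.choose 2 * gaussBinom q (3 * L) k =
      ∑ x ∈ antidiagonal k, ∑ y ∈ antidiagonal x.1,
        q ^ (3 * (y.1.choose 2 + y.2.choose 2 + x.2.choose 2) + y.2 + 2 * x.2) *
          (gaussBinom (q ^ 3) L y.1 * gaussBinom (q ^ 3) L y.2 * gaussBinom (q ^ 3) L x.2) := by
  have h := coeff_prod_one_add_mul_X q 1 (3 * L) k
  have hsplit : ∏ i ∈ range (3 * L), (1 + C (1 * q ^ i) * X : R[X]) =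
      (∏ i ∈ range L, (1 + C (1 * (q ^ 3) ^ i) * X)) *
        (∏ i ∈ range L, (1 + C (q * (q ^ 3) ^ i) * X)) *
        ∏ i ∈ range L, (1 + C (q ^ 2 * (q ^ 3) ^ i) * X) := by
    clear h
    induction L with
    | zero => simp
    | succ L ih =>
      rw [show 3 * (L + 1) = 3 * L + 1 + 1 + 1 by ring]
      simp only [prod_range_succ]
      rw [ih]
      have h1 : q * (q ^ 3) ^ L = 1 * q ^ (3 * L + 1) := by ring
      have h2 : q ^ 2 * (q ^ 3) ^ L = 1 * q ^ (3 * L + 1 + 1) := by ring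
      rw [h1, h2, ← pow_mul]
      ring
  rw [hsplit, coeff_mul] at h
  simp only [coeff_mul, coeff_prod_one_add_mul_X, one_pow, mul_one, sum_mul] at h
  rw [← h]
  refine sum_congr rfl fun x _ => sum_congr rfl fun y _ => ?_
  ring

end GaussBinom

/-- The exponent form of the theta series of `3`-cores; `3 * coreForm p + 1` is the norm of an
element of `ℤ[ω]` that is `1` modulo a prime above `3`. -/
def coreForm (p : ℤ × ℤ) : ℤ := 3 * (p.1 ^ 2 + p.1 * p.2 + p.2 ^ 2) + p.1 + 2 * p.2

lemma coreForm_nonneg (p : ℤ × ℤ) : 0 ≤ coreForm p := by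
  obtain ⟨a, b⟩ := p
  have h1 : 0 < (3 * b + 1) ^ 2 := by
    have : 3 * b + 1 ≠ 0 := by omega
    positivity
  have h2 : 12 * coreForm (a, b) + 4 = (6 * a + (3 * b + 1)) ^ 2 + 3 * (3 * b + 1) ^ 2 := by
    simp only [coreForm]; ring
  have := sq_nonneg (6 * a + (3 * b + 1))
  omega

lemma abs_le_of_coreForm_lt {a b K : ℤ} (h : coreForm (a, b) < K) :
    |a| ≤ 2 * K ∧ |b| ≤ 2 * K ∧ |a + b| ≤ 2 * K := by
  have h0 := coreForm_nonneg (a, b)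
  simp only [coreForm] at h h0
  have ha : 27 * a ^ 2 ≤ 12 * K + 4 := by nlinarith [sq_nonneg (2 * (3 * b + 1) + 3 * a)]
  have hb : 3 * (3 * b + 1) ^ 2 ≤ 12 * K + 4 := by nlinarith [sq_nonneg (6 * a + (3 * b + 1))]
  have hc : 3 * (3 * (a + b) + 1) ^ 2 ≤ 12 * K + 4 := by
    nlinarith [sq_nonneg (3 * a - (3 * b + 1))]
  have hK : 1 ≤ K := by linarith
  refine ⟨abs_le.2 ⟨?_, ?_⟩, abs_le.2 ⟨?_, ?_⟩, abs_le.2 ⟨?_, ?_⟩⟩ <;> nlinarith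

/-- Multiplication by `-2` on `ℤ[ω]` in the coordinates of `coreForm`. -/
lemma setOf_coreForm_eq_image (n : ℤ) :
    {p | coreForm p = 4 * n + 1} = (fun p : ℤ × ℤ => (-2 * p.1, -2 * p.2 - 1)) ''
      {p | coreForm p = n} := by
  ext ⟨a, b⟩
  simp only [Set.mem_ofPred_eq, Set.mem_image, Prod.mk.injEq, Prod.exists]
  constructor
  · intro h
    have key : ∃ c d, a = -2 * c ∧ b = -2 * d - 1 := by
      simp only [coreForm] at h
      rcases Int.even_or_odd' a with ⟨c, rfl | rfl⟩ <;>
        rcases Int.even_or_odd' b with ⟨d, rfl | rfl⟩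
      · exfalso; ring_nf at h; omega
      · exact ⟨-c, -d - 1, by ring, by ring⟩
      · exfalso; ring_nf at h; omega
      · exfalso; ring_nf at h; omega
    obtain ⟨c, d, rfl, rfl⟩ := key
    refine ⟨c, d, ?_, rfl, rfl⟩
    simp only [coreForm] at h ⊢
    linarith
  · rintro ⟨c, d, h, rfl, rfl⟩
    simp only [coreForm] at h ⊢
    linarith

lemma ncard_coreForm_four_mul_add_one (n : ℤ) :
    {p | coreForm p = 4 * n + 1}.ncard = {p | coreForm p = n}.ncard := by
  rw [setOf_coreForm_eq_image, Set.ncard_image_of_injective]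
  rintro ⟨a, b⟩ ⟨c, d⟩ h
  simp only [Prod.mk.injEq] at h ⊢
  omega

lemma two_mul_choose_two (k : ℕ) : 2 * (k.choose 2 : ℤ) = k * (k - 1) := by
  induction k with
  | zero => simp
  | succ k ih =>
    rw [Nat.choose_succ_succ' k 1, Nat.choose_one_right]
    push_cast
    linarith

lemma exponent_eq_choose_add_coreForm {M i j k : ℕ} (h : i + j + k = 3 * M) :
    3 * (i.choose 2 + j.choose 2 + k.choose 2) + j + 2 * k =
      (3 * M).choose 2 + (coreForm (j - M, k - M)).toNat := by
  zify
  rw [Int.toNat_of_nonneg (coreForm_nonneg _)]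
  have hi : (i : ℤ) = 3 * M - j - k := by omega
  have h1 := two_mul_choose_two i
  have h2 := two_mul_choose_two j
  have h3 := two_mul_choose_two k
  have h4 := two_mul_choose_two (3 * M)
  push_cast at h4
  rw [hi] at h1
  simp only [coreForm]
  linarith

section Theta

variable {S : Type*} [CommRing S]

lemma gaussBinom_eq_sum (q : S) (M : ℕ) :
    gaussBinom q (6 * M) (3 * M) =
      ∑ x ∈ antidiagonal (3 * M), ∑ y ∈ antidiagonal x.1,
        q ^ (coreForm (y.2 - M, x.2 - M)).toNat *
          (gaussBinom (q ^ 3) (2 * M) y.1 * gaussBinom (q ^ 3) (2 * M) y.2 *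
            gaussBinom (q ^ 3) (2 * M) x.2) := by
  have hX : gaussBinom (Polynomial.X : Polynomial ℤ) (6 * M) (3 * M) =
      ∑ x ∈ antidiagonal (3 * M), ∑ y ∈ antidiagonal x.1,
        Polynomial.X ^ (coreForm (y.2 - M, x.2 - M)).toNat *
          (gaussBinom (Polynomial.X ^ 3) (2 * M) y.1 *
            gaussBinom (Polynomial.X ^ 3) (2 * M) y.2 *
            gaussBinom (Polynomial.X ^ 3) (2 * M) x.2) := by
    apply mul_left_cancel₀ (pow_ne_zero ((3 * M).choose 2) Polynomial.X_ne_zero)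
    rw [show 6 * M = 3 * (2 * M) by ring, gaussBinom_three_mul, mul_sum]
    refine sum_congr rfl fun x hx => ?_
    rw [mul_sum]
    refine sum_congr rfl fun y hy => ?_
    rw [HasAntidiagonal.mem_antidiagonal] at hx hy
    rw [exponent_eq_choose_add_coreForm (by omega : y.1 + y.2 + x.2 = 3 * M), pow_add, mul_assoc]
  have := congrArg (Polynomial.eval₂RingHom (Int.castRingHom S) q) hX
  simpa [map_gaussBinom, map_sum, -Polynomial.coe_eval₂RingHom,
    show Polynomial.eval₂RingHom (Int.castRingHom S) q Polynomial.X = q by simp] using this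

lemma qPoch_eq_of_le {q : S} {K m : ℕ} (hq : q ^ K = 0) (hm : K ≤ m) :
    qPoch q m = qPoch q K := by
  induction m, hm using Nat.le_induction with
  | base => rfl
  | succ m hm ih => rw [qPoch_succ, ih, pow_eq_zero_of_le (by omega) hq]; simp

lemma isUnit_qPoch {q : S} (hq : IsNilpotent q) (n : ℕ) : IsUnit (qPoch q n) := by
  induction n with
  | zero => simp [qPoch]
  | succ n ih =>
    rw [qPoch_succ]
    exact ih.mul (hq.pow_succ n).isUnit_one_sub

lemma gaussBinom_mul_qPoch {q : S} {K N k : ℕ} (hq : q ^ K = 0) (hk : K ≤ k) (hN : k + K ≤ N) :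
    gaussBinom q N k * qPoch q K = 1 := by
  obtain ⟨m, rfl⟩ := Nat.exists_eq_add_of_le (by omega : k ≤ N)
  have h := gaussBinom_mul_qPoch_mul_qPoch q k m
  rw [qPoch_eq_of_le hq hk, qPoch_eq_of_le hq (by omega : K ≤ m),
    qPoch_eq_of_le hq (by omega : K ≤ k + m)] at h
  exact (isUnit_qPoch ⟨K, hq⟩ K).mul_right_cancel (h.trans (one_mul _).symm)

/-- The generating function of `3`-cores, for a nilpotent `q`. -/
lemma qPoch_pow_three_eq {q : S} {K : ℕ} (hq : q ^ K = 0) :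
    qPoch (q ^ 3) K ^ 3 = qPoch q K *
      ∑ x ∈ antidiagonal (3 * (3 * K)), ∑ y ∈ antidiagonal x.1,
        q ^ (coreForm (y.2 - (3 * K : ℕ), x.2 - (3 * K : ℕ))).toNat := by
  have hq3 : (q ^ 3) ^ K = 0 := by rw [← pow_mul, mul_comm, pow_mul, hq, zero_pow (by norm_num)]
  have h := gaussBinom_eq_sum q (3 * K)
  have h1 := gaussBinom_mul_qPoch hq (by omega : K ≤ 3 * (3 * K))
    (by omega : 3 * (3 * K) + K ≤ 6 * (3 * K))
  have key : gaussBinom q (6 * (3 * K)) (3 * (3 * K)) * qPoch (q ^ 3) K ^ 3 =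
      ∑ x ∈ antidiagonal (3 * (3 * K)), ∑ y ∈ antidiagonal x.1,
        q ^ (coreForm (y.2 - (3 * K : ℕ), x.2 - (3 * K : ℕ))).toNat := by
    rw [h, sum_mul]
    refine sum_congr rfl fun x hx => ?_
    rw [sum_mul]
    refine sum_congr rfl fun y hy => ?_
    rw [HasAntidiagonal.mem_antidiagonal] at hx hy
    by_cases hlt : coreForm (y.2 - (3 * K : ℕ), x.2 - (3 * K : ℕ)) < K
    · obtain ⟨ha, hb, hc⟩ := abs_le_of_coreForm_lt hlt
      rw [abs_le] at ha hb hc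
      have e1 := gaussBinom_mul_qPoch hq3 (by omega : K ≤ y.1)
        (by omega : y.1 + K ≤ 2 * (3 * K))
      have e2 := gaussBinom_mul_qPoch hq3 (by omega : K ≤ y.2)
        (by omega : y.2 + K ≤ 2 * (3 * K))
      have e3 := gaussBinom_mul_qPoch hq3 (by omega : K ≤ x.2)
        (by omega : x.2 + K ≤ 2 * (3 * K))
      calc _ = q ^ (coreForm (y.2 - (3 * K : ℕ), x.2 - (3 * K : ℕ))).toNat *
            ((gaussBinom (q ^ 3) (2 * (3 * K)) y.1 * qPoch (q ^ 3) K) *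
            (gaussBinom (q ^ 3) (2 * (3 * K)) y.2 * qPoch (q ^ 3) K) *
            (gaussBinom (q ^ 3) (2 * (3 * K)) x.2 * qPoch (q ^ 3) K)) := by ring
        _ = _ := by rw [e1, e2, e3]; ring
    · rw [pow_eq_zero_of_le (by omega) hq]
      simp
  rw [← key]
  linear_combination -qPoch (q ^ 3) K ^ 3 * h1

lemma qPoch_pow_eight_eq (h3 : (3 : S) = 0) {q : S} {K : ℕ} (hq : q ^ K = 0) :
    qPoch q K ^ 8 =
      ∑ x ∈ antidiagonal (3 * (3 * K)), ∑ y ∈ antidiagonal x.1,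
        q ^ (coreForm (y.2 - (3 * K : ℕ), x.2 - (3 * K : ℕ))).toNat := by
  have hcube : qPoch (q ^ 3) K = qPoch q K ^ 3 := by
    rw [qPoch, qPoch, ← prod_pow]
    refine prod_congr rfl fun i _ => ?_
    linear_combination (q ^ (i + 1) - (q ^ (i + 1)) ^ 2) * h3
  have h := qPoch_pow_three_eq hq
  rw [hcube] at h
  refine (isUnit_qPoch ⟨K, hq⟩ K).mul_left_cancel (Eq.trans ?_ h)
  ring

end Theta

open PowerSeries

lemma coeff_sum_X_pow_coreForm {n K : ℕ} (hn : n < K) :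
    coeff n (∑ x ∈ antidiagonal (3 * (3 * K)), ∑ y ∈ antidiagonal x.1,
      (X : (ZMod 3)⟦X⟧) ^ (coreForm (y.2 - (3 * K : ℕ), x.2 - (3 * K : ℕ))).toNat) =
      ({p | coreForm p = n}.ncard : ZMod 3) := by
  rw [sum_sigma', map_sum]
  simp only [coeff_X_pow]
  rw [sum_boole, ← Set.ncard_coe_finset]
  congr 1
  refine Set.ncard_congr (fun z _ => ((z.2.2 : ℤ) - (3 * K : ℕ), (z.1.2 : ℤ) - (3 * K : ℕ)))
    ?_ ?_ ?_
  · intro z hz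
    rw [mem_coe, mem_filter] at hz
    have := coreForm_nonneg ((z.2.2 : ℤ) - (3 * K : ℕ), (z.1.2 : ℤ) - (3 * K : ℕ))
    rw [Set.mem_ofPred_eq]
    omega
  · rintro ⟨⟨a, b⟩, c, d⟩ ⟨⟨a', b'⟩, c', d'⟩ hz hz' h
    simp only [mem_coe, mem_filter, mem_sigma, HasAntidiagonal.mem_antidiagonal, Prod.mk.injEq] at hz hz' h
    obtain ⟨rfl, rfl, rfl, rfl⟩ : a = a' ∧ b = b' ∧ c = c' ∧ d = d' := by omega
    rfl
  · rintro ⟨a, b⟩ h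
    rw [Set.mem_ofPred_eq] at h
    obtain ⟨ha, hb, hc⟩ := abs_le_of_coreForm_lt (h.trans_lt (Int.ofNat_lt.2 hn))
    rw [abs_le] at ha hb hc
    refine ⟨⟨((6 * K - b).toNat, (3 * K + b).toNat), ((3 * K - a - b).toNat, (3 * K + a).toNat)⟩,
      ?_, ?_⟩
    · simp only [mem_coe, mem_filter, mem_sigma, HasAntidiagonal.mem_antidiagonal]
      refine ⟨⟨by omega, by omega⟩, ?_⟩
      rw [Int.toNat_of_nonneg (by omega), Int.toNat_of_nonneg (by omega)]
      push_cast
      simp [h]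
    · simp only [Prod.mk.injEq]
      omega

lemma coeff_qPoch_X_pow_eight {n K : ℕ} (hn : n < K) :
    coeff n (qPoch (X : (ZMod 3)⟦X⟧) K ^ 8) = ({p | coreForm p = n}.ncard : ZMod 3) := by
  rw [← coeff_sum_X_pow_coreForm hn]
  let f := Ideal.Quotient.mk (Ideal.span {(X : (ZMod 3)⟦X⟧) ^ K})
  have hf : f X ^ K = 0 := by
    rw [← map_pow]
    exact Ideal.Quotient.eq_zero_iff_mem.2 (Ideal.mem_span_singleton_self _)
  have h3 : (3 : (ZMod 3)⟦X⟧ ⧸ Ideal.span {(X : (ZMod 3)⟦X⟧) ^ K}) = 0 := by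
    have h : (3 : (ZMod 3)⟦X⟧) = 0 := by
      rw [← map_ofNat (C (R := ZMod 3)) 3, show (OfNat.ofNat 3 : ZMod 3) = 0 from rfl, map_zero]
    rw [← map_ofNat f 3, ← map_zero f]
    exact congrArg f h
  have h := qPoch_pow_eight_eq h3 hf
  have hmap : qPoch (f X) K = f (qPoch X K) := by simp [qPoch, map_prod]
  simp only [hmap, ← map_pow, ← map_sum] at h
  rw [Ideal.Quotient.eq, Ideal.mem_span_singleton, X_pow_dvd_iff] at h
  exact sub_eq_zero.1 ((map_sub _ _ _).symm.trans (h n hn))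

open PowerSeries.WithPiTopology Filter in
lemma exists_coeff_qPoch_eq (n : ℕ) :
    ∃ K, n < K ∧ coeff n (qPoch (X : (ZMod 3)⟦X⟧) K ^ 8) = (numRegular 9 n : ZMod 3) := by
  let _ : TopologicalSpace (ZMod 3) := ⊥
  have _ : DiscreteTopology (ZMod 3) := ⟨rfl⟩
  have h := (Nat.Partition.hasProd_powerSeriesMk_card_countRestricted (ZMod 3)
    (by norm_num : 0 < 9)).tendsto_prod_nat
  have h := (WithPiTopology.tendsto_iff_coeff_tendsto _ _ _ _).1 h n
  rw [nhds_discrete, tendsto_pure] at h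
  obtain ⟨K, hK, hn⟩ := (h.and (eventually_gt_atTop n)).exists
  refine ⟨K, hn, ?_⟩
  rw [coeff_mk, ← Nat.Partition.card_restricted_eq_card_countRestricted n (by norm_num)] at hK
  refine Eq.trans ?_ hK
  rw [qPoch, ← prod_pow]
  congr 1
  refine prod_congr rfl fun i _ => ?_
  have h3 : (3 : (ZMod 3)⟦X⟧) = 0 := by
    rw [← map_ofNat (C (R := ZMod 3)) 3, show (OfNat.ofNat 3 : ZMod 3) = 0 from rfl, map_zero]
  simp only [sum_range_succ, sum_range_zero, pow_mul]
  generalize (X : (ZMod 3)⟦X⟧) ^ (i + 1) = y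
  linear_combination (-3 * y + 9 * y ^ 2 - 19 * y ^ 3 + 23 * y ^ 4 - 19 * y ^ 5 + 9 * y ^ 6
    - 3 * y ^ 7) * h3

lemma numRegular_nine_eq_ncard (n : ℕ) :
    (numRegular 9 n : ZMod 3) = ({p | coreForm p = n}.ncard : ZMod 3) := by
  obtain ⟨K, hn, h⟩ := exists_coeff_qPoch_eq n
  rw [← h, coeff_qPoch_X_pow_eight hn]

/-- The self-similarity `b_9(4n+1) ≡ b_9(n) (mod 3)` for every nonnegative integer `n`. -/
theorem b9_self_similarity (n : ℕ) : numRegular 9 (4 * n + 1) ≡ numRegular 9 n [MOD 3] := by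
  rw [← ZMod.natCast_eq_natCast_iff, numRegular_nine_eq_ncard, numRegular_nine_eq_ncard]
  push_cast
  rw [ncard_coreForm_four_mul_add_one]
end
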